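/- Let k be an algebraically closed field of characteristic p, let S be a complete noetherian local k-algebra with residue field k, and let (x_1, …, x_d) be a system of parameters of S. Let (D_α)_{α ∈ I} be a directed system of S-algebras over a directed index set I, with S-algebra transition maps D_α → D_β for α ≤ β, such that each D_α is equipped with a compatible system of p-th power roots of a nonzero element π_α ∈ D_α making D_α a π_α^{1/p^∞}-almost Cohen-Macaulay S-algebra with respect to (x_1, …, x_d). Then the direct limit colim_α D_α admits an S-algebra homomorphism to an S-algebra C which is a domain, a perfect ring (Frobenius x ↦ x^p bijective), and a (big) Cohen-Macaulay S-algebra. -/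

import Mathlib

/-- A finite sequence `y` of elements of a commutative ring `B` is a regular sequence on `B`:
for each `i`, multiplication by `y i` is injective on `B/(y_1,…,y_{i-1})B`,
and `B ≠ (y_1,…,y_m)B`. -/
def IsRegSeq {B : Type*} [CommRing B] {m : ℕ} (y : Fin m → B) : Prop :=
  (∀ i : Fin m, ∀ b : B,
      y i * b ∈ Ideal.span (y '' {j : Fin m | j < i}) →
        b ∈ Ideal.span (y '' {j : Fin m | j < i})) ∧
  Ideal.span (Set.range y) ≠ ⊤

/-- A `B`-algebra (given by a ring hom `φ : R →+* B`) is Cohen-Macaulay with respect to a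
sequence `x` of elements of `R` if `x` becomes a regular sequence in `B`. -/
def IsCMwrt {R B : Type*} [CommRing R] [CommRing B] (φ : R →+* B)
    {d : ℕ} (x : Fin d → R) : Prop :=
  IsRegSeq fun i => φ (x i)

/-- `x` is a system of parameters of the noetherian local ring `R`: `d` is the Krull dimension,
all `x i` lie in the maximal ideal, and they generate an ideal whose radical is the maximal
ideal. -/
def IsSOP (R : Type*) [CommRing R] [IsLocalRing R] {d : ℕ} (x : Fin d → R) : Prop :=
  (d : WithBot ℕ∞) = ringKrullDim R ∧
  (∀ i, x i ∈ IsLocalRing.maximalIdeal R) ∧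
  (Ideal.span (Set.range x)).radical = IsLocalRing.maximalIdeal R

/-- `B` (via the structure map `φ`) is a big Cohen-Macaulay `R`-algebra: it is Cohen-Macaulay
with respect to every system of parameters of `R`. -/
def IsBigCM {R B : Type*} [CommRing R] [IsLocalRing R] [CommRing B] (φ : R →+* B) : Prop :=
  ∀ (d : ℕ) (x : Fin d → R), IsSOP R x → IsCMwrt φ x

/-- `A` (as an `R`-algebra) is an absolute integral closure of the domain `R`:
it is a domain containing `R`, integral over `R`, and absolutely integrally closed
(every monic polynomial of positive degree has a root); equivalently, it is the
integral closure of `R` in an algebraic closure of its fraction field. -/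
structure IsAbsIntClosure (R A : Type*) [CommRing R] [CommRing A] [Algebra R A] : Prop where
  isDomain : IsDomain A
  injective : Function.Injective (algebraMap R A)
  isIntegral : Algebra.IsIntegral R A
  monic_root : ∀ P : Polynomial A, P.Monic → 0 < P.degree → ∃ a : A, P.IsRoot a

/-- `B` is `π^{1/p^∞}`-almost Cohen-Macaulay with respect to `x`, where `π : ℕ → B` is a
compatible system of `p`-th power roots. -/
def IsAlmostCMwrt {R B : Type*} [CommRing R] [CommRing B] (φ : R →+* B)
    (π : ℕ → B) {d : ℕ} (x : Fin d → R) : Prop :=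
  (∀ i : Fin d, ∀ b : B,
      φ (x i) * b ∈ Ideal.span ((fun j => φ (x j)) '' {j : Fin d | j < i}) →
        ∀ e : ℕ, π e * b ∈ Ideal.span ((fun j => φ (x j)) '' {j : Fin d | j < i})) ∧
  ¬ Ideal.span (Set.range π) ≤ Ideal.span (Set.range fun j => φ (x j))

/-- Multiplication by `a` is injective on `B ⧸ I`. -/
def IsRegMod {B : Type*} [CommRing B] (I : Ideal B) (a : B) : Prop :=
  ∀ b, a * b ∈ I → b ∈ I

/-- The list `l` is a weakly regular sequence on `B ⧸ I`. -/
def IsWeaklyRegMod {B : Type*} [CommRing B] : Ideal B → List B → Prop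
  | _, [] => True
  | I, a :: l => IsRegMod I a ∧ IsWeaklyRegMod (I ⊔ Ideal.span {a}) l

section RegularSequences

variable {B : Type*} [CommRing B]

lemma Ideal.mem_sup_span_singleton_iff {I : Ideal B} {a b : B} :
    b ∈ I ⊔ Ideal.span {a} ↔ ∃ c, b - a * c ∈ I := by
  rw [Submodule.mem_sup]
  constructor
  · rintro ⟨i, hi, z, hz, rfl⟩
    obtain ⟨c, rfl⟩ := Ideal.mem_span_singleton'.1 hz
    exact ⟨c, by simpa [mul_comm] using hi⟩
  · rintro ⟨c, hc⟩
    exact ⟨_, hc, a * c, Ideal.mul_mem_right _ _ (Ideal.mem_span_singleton_self a), by ring⟩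

lemma IsRegMod.sup_span_singleton {I : Ideal B} {r s : B} (hr : IsRegMod I r)
    (hs : IsRegMod (I ⊔ Ideal.span {r}) s) : IsRegMod (I ⊔ Ideal.span {s}) r := by
  intro b hb
  obtain ⟨c, hc⟩ := Ideal.mem_sup_span_singleton_iff.1 hb
  have hc' : c ∈ I ⊔ Ideal.span {r} := by
    refine hs c (Ideal.mem_sup_span_singleton_iff.2 ⟨b, ?_⟩)
    simpa using I.neg_mem hc
  obtain ⟨c', hc''⟩ := Ideal.mem_sup_span_singleton_iff.1 hc'
  refine Ideal.mem_sup_span_singleton_iff.2 ⟨c', hr _ ?_⟩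
  have := I.add_mem hc (I.mul_mem_left s hc'')
  convert this using 1
  ring

lemma IsRegMod.mul_sup {I : Ideal B} {a b s : B} (ha : IsRegMod I a)
    (hsa : IsRegMod (I ⊔ Ideal.span {a}) s) (hsb : IsRegMod (I ⊔ Ideal.span {b}) s) :
    IsRegMod (I ⊔ Ideal.span {a * b}) s := by
  intro c hc
  obtain ⟨e, he⟩ := Ideal.mem_sup_span_singleton_iff.1 hc
  have h1 : c ∈ I ⊔ Ideal.span {a} :=
    hsa c (Ideal.mem_sup_span_singleton_iff.2 ⟨b * e, by convert he using 1; ring⟩)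
  obtain ⟨c1, hc1⟩ := Ideal.mem_sup_span_singleton_iff.1 h1
  have h2 : c1 ∈ I ⊔ Ideal.span {b} := by
    refine hsb c1 (Ideal.mem_sup_span_singleton_iff.2 ⟨e, ha _ ?_⟩)
    convert I.sub_mem he (I.mul_mem_left s hc1) using 1
    ring
  obtain ⟨c2, hc2⟩ := Ideal.mem_sup_span_singleton_iff.1 h2
  refine Ideal.mem_sup_span_singleton_iff.2 ⟨c2, ?_⟩
  convert I.add_mem hc1 (I.mul_mem_left a hc2) using 1
  ring

lemma IsWeaklyRegMod.head_sup_tail {l : List B} {I : Ideal B} {r : B}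
    (h : IsWeaklyRegMod I (r :: l)) : IsRegMod (I ⊔ Ideal.ofList l) r := by
  induction l generalizing I with
  | nil => simpa using h.1
  | cons s l ih =>
    rw [Ideal.ofList_cons, ← sup_assoc]
    refine ih ⟨h.1.sup_span_singleton h.2.1, ?_⟩
    rw [sup_right_comm]
    exact h.2.2

lemma IsWeaklyRegMod.cons_mul {l : List B} {I : Ideal B} {a b : B}
    (ha : IsWeaklyRegMod I (a :: l)) (hb : IsWeaklyRegMod I (b :: l)) :
    IsWeaklyRegMod I (a * b :: l) := by
  refine ⟨fun c hc => hb.1 _ (ha.1 _ (by rwa [← mul_assoc])), ?_⟩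
  induction l generalizing I with
  | nil => trivial
  | cons s l ih =>
    refine ⟨ha.1.mul_sup ha.2.1 hb.2.1, ?_⟩
    rw [sup_right_comm]
    refine ih ⟨ha.1.sup_span_singleton ha.2.1, ?_⟩ ⟨hb.1.sup_span_singleton hb.2.1, ?_⟩
    · rw [sup_right_comm]; exact ha.2.2
    · rw [sup_right_comm]; exact hb.2.2

lemma IsWeaklyRegMod.cons_pow {l : List B} {I : Ideal B} {a : B}
    (h : IsWeaklyRegMod I (a :: l)) {n : ℕ} (hn : 0 < n) : IsWeaklyRegMod I (a ^ n :: l) := by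
  induction n, hn using Nat.le_induction with
  | base => simpa using h
  | succ n _ ih => rw [pow_succ]; exact ih.cons_mul h

lemma IsWeaklyRegMod.pow_entries {l : List B} {I : Ideal B} (h : IsWeaklyRegMod I l)
    {n : ℕ} (hn : 0 < n) : IsWeaklyRegMod I (l.map (· ^ n)) := by
  induction l generalizing I with
  | nil => trivial
  | cons a l ih => exact IsWeaklyRegMod.cons_pow ⟨h.1, ih h.2⟩ hn

lemma isWeaklyRegMod_append {l l' : List B} {I : Ideal B} :
    IsWeaklyRegMod I (l ++ l') ↔ IsWeaklyRegMod I l ∧ IsWeaklyRegMod (I ⊔ Ideal.ofList l) l' := by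
  induction l generalizing I with
  | nil => simp [IsWeaklyRegMod]
  | cons a l ih =>
    rw [List.cons_append, Ideal.ofList_cons, ← sup_assoc]
    simp only [IsWeaklyRegMod, ih, and_assoc]

lemma isWeaklyRegMod_ofFn {d : ℕ} {y : Fin d → B} {I : Ideal B} :
    IsWeaklyRegMod I (List.ofFn y) ↔
      ∀ i : Fin d, IsRegMod (I ⊔ Ideal.span (y '' {j | j < i})) (y i) := by
  induction d generalizing I with
  | zero => simp [IsWeaklyRegMod]
  | succ d ih =>
    rw [List.ofFn_succ, IsWeaklyRegMod, ih, Fin.forall_fin_succ]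
    refine and_congr (by simp) (forall_congr' fun i => ?_)
    rw [sup_assoc, ← Ideal.span_union]
    suffices h : {y 0} ∪ (fun i => y (Fin.succ i)) '' {j | j < i} = y '' {j | j < i.succ} by rw [h]
    ext z
    simp only [Set.mem_union, Set.mem_singleton_iff, Set.mem_image]
    constructor
    · rintro (rfl | ⟨j, hj, rfl⟩)
      · exact ⟨0, Fin.succ_pos i, rfl⟩
      · exact ⟨j.succ, Fin.succ_lt_succ_iff.2 hj, rfl⟩
    · rintro ⟨j, hj, rfl⟩
      rcases Fin.eq_zero_or_eq_succ j with rfl | ⟨j, rfl⟩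
      · exact Or.inl rfl
      · exact Or.inr ⟨j, Fin.succ_lt_succ_iff.1 hj, rfl⟩

/-- An ideal `I` for which `B ⧸ I` contains no nontrivial sequence of successive quotients by an
element of `M`. -/
def IsChainFree (M : Set B) (I : Ideal B) : Prop :=
  ∀ a ∈ M, ∀ u : ℕ → B, (∀ n, u n - a * u (n + 1) ∈ I) → ∀ n, u n ∈ I

lemma IsChainFree.swap {M : Set B} {I : Ideal B} (hI : IsChainFree M I) {a b : B} (ha : a ∈ M)
    {l : List B} (h : IsWeaklyRegMod I (a :: b :: l)) : IsWeaklyRegMod I (b :: a :: l) := by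
  refine ⟨?_, h.1.sup_span_singleton h.2.1, by rw [sup_right_comm]; exact h.2.2⟩
  have key : ∀ u, b * u ∈ I → ∃ v, b * v ∈ I ∧ u - a * v ∈ I := by
    intro u hu
    obtain ⟨v, hv⟩ := Ideal.mem_sup_span_singleton_iff.1 (h.2.1 u (Ideal.mem_sup_left hu))
    refine ⟨v, h.1 _ ?_, hv⟩
    convert I.sub_mem hu (I.mul_mem_left b hv) using 1
    ring
  choose f hf hf' using key
  intro u hu
  let w : ℕ → {u // b * u ∈ I} := fun n => Nat.rec ⟨u, hu⟩ (fun _ v => ⟨f v.1 v.2, hf v.1 v.2⟩) n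
  exact hI a ha (fun n => (w n).1) (fun n => hf' (w n).1 (w n).2) 0

/-- Every weakly regular sequence with entries in `M` may be permuted. -/
lemma IsWeaklyRegMod.perm {M : Set B} (hsup : ∀ I : Ideal B, IsChainFree M I →
      ∀ a ∈ M, IsChainFree M (I ⊔ Ideal.span {a})) {l l' : List B} (hl : l.Perm l')
    {I : Ideal B} (hI : IsChainFree M I) (hM : ∀ a ∈ l, a ∈ M) (h : IsWeaklyRegMod I l) :
    IsWeaklyRegMod I l' := by
  induction hl generalizing I with
  | nil => trivial
  | cons a _ ih =>
    exact ⟨h.1, ih (hsup I hI a (hM a (by simp))) (fun b hb => hM b (by simp [hb])) h.2⟩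
  | swap a b l => exact hI.swap (hM _ (by simp)) h
  | trans h1 _ ih1 ih2 =>
    exact ih2 hI (fun a ha => hM a (h1.mem_iff.2 ha)) (ih1 hI hM h)

end RegularSequences

section SystemsOfParameters

variable {S : Type*} [CommRing S] [IsLocalRing S]

open IsLocalRing

lemma Ideal.radical_eq_maximalIdeal_iff {I : Ideal S} :
    I.radical = maximalIdeal S ↔ I ≤ maximalIdeal S ∧
      ∀ P : Ideal S, P.IsPrime → I ≤ P → P = maximalIdeal S := by
  constructor
  · intro h
    refine ⟨h ▸ Ideal.le_radical, fun P hP hIP => le_antisymm (le_maximalIdeal hP.ne_top) ?_⟩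
    rw [← h]
    exact hP.radical_le_iff.2 hIP
  · rintro ⟨h1, h2⟩
    refine le_antisymm ((maximalIdeal.isMaximal S).isPrime.radical_le_iff.2 h1) ?_
    rw [Ideal.radical_eq_sInf]
    exact le_sInf fun P hP => (h2 P hP.2 hP.1).ge

lemma exists_common_last_parameter [IsNoetherianRing S] {l₁ l₂ : List S} {a₁ a₂ : S}
    (h₁ : (Ideal.ofList (l₁ ++ [a₁])).radical = maximalIdeal S)
    (h₂ : (Ideal.ofList (l₂ ++ [a₂])).radical = maximalIdeal S)
    (hd₁ : (l₁.length : ℕ∞) < (maximalIdeal S).height)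
    (hd₂ : (l₂.length : ℕ∞) < (maximalIdeal S).height) :
    ∃ w, (Ideal.ofList (l₁ ++ [w])).radical = maximalIdeal S ∧
      (Ideal.ofList (l₂ ++ [w])).radical = maximalIdeal S := by
  classical
  have hlt : ∀ l : List S, (l.length : ℕ∞) < (maximalIdeal S).height →
      maximalIdeal S ∉ (Ideal.ofList l).minimalPrimes := by
    intro l hl hmem
    have h := Ideal.height_le_card_of_mem_minimalPrimes_span_finset (s := l.toFinset)
      (p := maximalIdeal S) (by simpa [Ideal.ofList] using hmem)
    exact absurd (hl.trans_le h) (by exact_mod_cast not_lt.2 l.toFinset_card_le)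
  have hfin : ((Ideal.ofList l₁).minimalPrimes ∪ (Ideal.ofList l₂).minimalPrimes).Finite :=
    (Ideal.finite_minimalPrimes_of_isNoetherianRing S _).union
      (Ideal.finite_minimalPrimes_of_isNoetherianRing S _)
  have hex : ∃ w ∈ maximalIdeal S,
      ∀ P ∈ (Ideal.ofList l₁).minimalPrimes ∪ (Ideal.ofList l₂).minimalPrimes, w ∉ P := by
    by_contra! hcon
    have hsub : (maximalIdeal S : Set S) ⊆ ⋃ P ∈ (hfin.toFinset : Set (Ideal S)), (P : Set S) := by
      intro w hw
      obtain ⟨P, hP, hwP⟩ := hcon w hw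
      simp only [Set.mem_iUnion]
      exact ⟨P, by simpa using hP, hwP⟩
    obtain ⟨P, hP, hmP⟩ := (Ideal.subset_union_prime (f := id) ⊤ ⊤ (fun P hP _ _ => by
      rcases hfin.mem_toFinset.1 hP with h | h <;> exact h.isPrime)).1 hsub
    rw [Set.Finite.mem_toFinset] at hP
    have hPp : P.IsPrime := by rcases hP with h | h <;> exact h.isPrime
    have hPm : P = maximalIdeal S := le_antisymm (le_maximalIdeal hPp.ne_top) hmP
    subst hPm
    exact hP.elim (hlt _ hd₁) (hlt _ hd₂)
  obtain ⟨w, hwm, hw⟩ := hex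
  have main : ∀ (l : List S) (a : S), (Ideal.ofList (l ++ [a])).radical = maximalIdeal S →
      (∀ P ∈ (Ideal.ofList l).minimalPrimes, w ∉ P) →
      (Ideal.ofList (l ++ [w])).radical = maximalIdeal S := by
    intro l a hla hwl
    rw [Ideal.radical_eq_maximalIdeal_iff] at hla ⊢
    rw [Ideal.ofList_append, Ideal.ofList_singleton] at hla ⊢
    refine ⟨sup_le (le_sup_left.trans hla.1) ((Ideal.span_singleton_le_iff_mem _).2 hwm), ?_⟩
    intro P hP hle
    by_contra hne
    have hPlt : P < maximalIdeal S := lt_of_le_of_ne (le_maximalIdeal hP.ne_top) hne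
    have hspan : Ideal.span (insert a {x | x ∈ l}) = Ideal.ofList l ⊔ Ideal.span {a} := by
      rw [Ideal.span_insert, sup_comm, Ideal.ofList]
    have hmin : P ∈ (Ideal.span {x | x ∈ l}).minimalPrimes := by
      refine Ideal.mem_minimalPrimes_span_of_mem_minimalPrimes_span_insert hPlt a {x | x ∈ l}
        ?_ {x | x ∈ l} ?_ ?_
      · rw [hspan]
        exact ⟨⟨(maximalIdeal.isMaximal S).isPrime, hla.1⟩, fun Q hQ _ => (hla.2 Q hQ.1 hQ.2).ge⟩
      · exact Ideal.span_le.1 (le_sup_left.trans hle)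
      · exact fun s hs => Ideal.le_radical (Ideal.subset_span (Set.mem_insert_of_mem _ hs))
    exact hwl P hmin (hle (Ideal.mem_sup_right (Ideal.mem_span_singleton_self w)))
  exact ⟨w, main l₁ a₁ h₁ fun P hP => hw P (Or.inl hP), main l₂ a₂ h₂ fun P hP => hw P (Or.inr hP)⟩

variable {B : Type*} [CommRing B] (φ : S →+* B)

lemma IsWeaklyRegMod.replace_last {l : List S} {a w : S}
    (ha : a ∈ maximalIdeal S) (hw : (Ideal.ofList (l ++ [w])).radical = maximalIdeal S)
    (h : IsWeaklyRegMod ⊥ ((l ++ [a]).map φ)) : IsWeaklyRegMod ⊥ ((l ++ [w]).map φ) := by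
  simp only [List.map_append, isWeaklyRegMod_append, bot_sup_eq, ← Ideal.map_ofList,
    List.map_singleton, IsWeaklyRegMod, and_true] at h ⊢
  refine ⟨h.1, ?_⟩
  rw [← hw, Ideal.ofList_append, Ideal.ofList_singleton] at ha
  obtain ⟨n, hn⟩ := ha
  obtain ⟨c, hc⟩ := Ideal.mem_sup_span_singleton_iff.1 hn
  have hpow : ∀ n, IsRegMod ((Ideal.ofList l).map φ) (φ a ^ n) := by
    intro n
    induction n with
    | zero => intro b; simp
    | succ n ih => exact fun b hb => h.2 _ (ih _ (by rwa [← mul_assoc, ← pow_succ]))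
  intro b hb
  refine hpow n b ?_
  have h1 := Ideal.mem_map_of_mem φ hc
  convert Ideal.add_mem _ (Ideal.mul_mem_right b _ h1) (Ideal.mul_mem_left _ (φ c) hb) using 1
  simp only [map_sub, map_mul, map_pow]
  ring

/-- Regularity of one system of parameters implies regularity of every other one, provided
`B` is sufficiently complete. -/
lemma IsWeaklyRegMod.of_systemOfParameters [IsNoetherianRing S]
    (hbot : IsChainFree (φ '' maximalIdeal S) (⊥ : Ideal B))
    (hsup : ∀ I : Ideal B, IsChainFree (φ '' maximalIdeal S) I →
      ∀ a ∈ φ '' maximalIdeal S, IsChainFree (φ '' maximalIdeal S) (I ⊔ Ideal.span {a}))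
    {l₁ l₂ z : List S} (hlen : l₁.length = l₂.length)
    (hd : ((l₁ ++ z).length : ℕ∞) = (maximalIdeal S).height)
    (h₁ : (Ideal.ofList (l₁ ++ z)).radical = maximalIdeal S)
    (h₂ : (Ideal.ofList (l₂ ++ z)).radical = maximalIdeal S)
    (h : IsWeaklyRegMod ⊥ ((l₁ ++ z).map φ)) : IsWeaklyRegMod ⊥ ((l₂ ++ z).map φ) := by
  have hmem : ∀ l : List S, (Ideal.ofList l).radical = maximalIdeal S →
      ∀ a ∈ l, a ∈ maximalIdeal S :=
    fun l hl a ha => hl ▸ Ideal.le_radical (Ideal.subset_span ha)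
  have hperm : ∀ l l' : List S, l.Perm l' → (Ideal.ofList l).radical = maximalIdeal S →
      IsWeaklyRegMod ⊥ (l.map φ) → IsWeaklyRegMod ⊥ (l'.map φ) := by
    intro l l' hl hr h
    refine IsWeaklyRegMod.perm hsup (hl.map φ) hbot ?_ h
    simp only [List.mem_map]
    rintro _ ⟨a, ha, rfl⟩
    exact ⟨a, hmem l hr a ha, rfl⟩
  have hspan : ∀ l l' : List S, l.Perm l' → Ideal.ofList l = Ideal.ofList l' := by
    intro l l' hl
    simp only [Ideal.ofList, hl.mem_iff]
  induction l₁ using List.reverseRecOn generalizing l₂ z with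
  | nil =>
    obtain rfl : l₂ = [] := List.length_eq_zero_iff.1 hlen.symm
    exact h
  | append_singleton l₁ a₁ ih =>
    obtain ⟨l₂, a₂, rfl⟩ : ∃ l a, l₂ = l ++ [a] := by
      rcases List.eq_nil_or_concat' l₂ with rfl | h
      · simp at hlen
      · exact h
    have hp : ∀ (l : List S) (a : S), (l ++ [a] ++ z).Perm (l ++ z ++ [a]) := by
      intro l a
      simp only [List.append_assoc]
      exact List.Perm.append_left l List.perm_append_comm
    have hp' : ∀ (l : List S) (a : S), (l ++ z ++ [a]).Perm (l ++ a :: z) := by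
      intro l a
      simpa using (hp l a).symm
    have hlen' : l₁.length = l₂.length := by simpa using hlen
    have hd' : ((l₁ ++ z).length : ℕ∞) < (maximalIdeal S).height := by
      rw [← hd]
      simp only [List.length_append, List.length_singleton]
      exact_mod_cast (by omega)
    have h₁' := h₁
    have h₂' := h₂
    rw [hspan _ _ (hp _ _)] at h₁' h₂'
    obtain ⟨w, hw₁, hw₂⟩ := exists_common_last_parameter h₁' h₂' hd'
      (by simpa [hlen'] using hd')
    have ha : ∀ (l : List S) (a : S), (Ideal.ofList (l ++ [a])).radical = maximalIdeal S →
      a ∈ maximalIdeal S := fun l a h => hmem _ h _ (by simp)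
    have e1 := IsWeaklyRegMod.replace_last φ (ha _ _ h₁') hw₁ (hperm _ _ (hp _ _) h₁ h)
    have hw₁' := hw₁
    have hw₂' := hw₂
    rw [hspan _ _ (hp' _ _)] at hw₁' hw₂'
    have e2 := ih hlen' (z := w :: z) (by rw [← hd]; simp) hw₁' hw₂'
      (hperm _ _ (hp' _ _) hw₁ e1)
    have e3 := IsWeaklyRegMod.replace_last φ (ha _ _ hw₂) h₂'
      (hperm _ _ (hp' _ _).symm hw₂' e2)
    exact hperm _ _ (hp _ _).symm h₂' e3

end SystemsOfParameters

section Constructions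

variable {S : Type*} [CommRing S]

lemma Ideal.mem_map_pi_iff {ι : Type*} {B : ι → Type*} [∀ i, CommRing (B i)]
    (φ : ∀ i, S →+* B i) {I : Ideal S} (hI : I.FG) {b : ∀ i, B i} :
    b ∈ I.map (RingHom.pi φ) ↔ ∀ i, b i ∈ I.map (φ i) := by
  constructor
  · intro hb i
    have := Ideal.mem_map_of_mem (Pi.evalRingHom B i) hb
    rwa [Ideal.map_map] at this
  · induction I, hI using Submodule.fg_induction generalizing b with
    | singleton a =>
      intro h
      have h' : ∀ i, ∃ c, c * φ i a = b i := by
        intro i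
        have := h i
        rw [Ideal.submodule_span_eq, Ideal.map_span, Set.image_singleton] at this
        exact Ideal.mem_span_singleton'.1 this
      choose c hc using h'
      have : b = c * RingHom.pi φ a := funext fun i => (hc i).symm
      rw [this]
      exact Ideal.mul_mem_left _ _ (Ideal.mem_map_of_mem _ (Ideal.mem_span_singleton_self a))
    | sup I J _ _ hI hJ =>
      intro h
      have h' : ∀ i, ∃ c ∈ Ideal.map (φ i) I, ∃ e ∈ Ideal.map (φ i) J, c + e = b i := by
        intro i
        have := h i
        rwa [Ideal.map_sup, Submodule.mem_sup] at this
      choose c hc e he hce using h'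
      rw [Ideal.map_sup, Submodule.mem_sup]
      exact ⟨c, hI hc, e, hJ he, funext hce⟩

lemma exists_reducedProduct {ι : Type} {B : ι → Type} [∀ i, CommRing (B i)]
    (F : Filter ι) (φ : ∀ i, S →+* B i) :
    ∃ (C : Type) (_ : CommRing C) (q : (∀ i, B i) →+* C), Function.Surjective q ∧
      ∀ I : Ideal S, I.FG → ∀ b, q b ∈ I.map (q.comp (RingHom.pi φ)) ↔
        ∀ᶠ i in F, b i ∈ I.map (φ i) := by
  classical
  let N : Ideal (∀ i, B i) :=
    { carrier := {b | ∀ᶠ i in F, b i = 0}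
      add_mem' := fun {a b} ha hb => by
        filter_upwards [ha, hb] with i h1 h2
        simp [h1, h2]
      zero_mem' := by simp
      smul_mem' := fun c b hb => by
        filter_upwards [hb] with i h
        simp [h] }
  refine ⟨_ ⧸ N, inferInstance, Ideal.Quotient.mk N, Ideal.Quotient.mk_surjective, ?_⟩
  intro I hI b
  rw [← Ideal.map_map, Ideal.mem_quotient_iff_mem_sup, Submodule.mem_sup]
  constructor
  · rintro ⟨c, hc, e, he, rfl⟩
    have he' : ∀ᶠ i in F, e i = 0 := he
    filter_upwards [he'] with i hi
    simpa [hi] using (Ideal.mem_map_pi_iff φ hI).1 hc i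
  · intro h
    let c : ∀ i, B i := fun i => if b i ∈ I.map (φ i) then b i else 0
    refine ⟨c, (Ideal.mem_map_pi_iff φ hI).2 fun i => ?_, b - c, ?_, by simp⟩
    · by_cases hi : b i ∈ I.map (φ i) <;> simp [c, hi]
    · change ∀ᶠ i in F, (b - c) i = 0
      filter_upwards [h] with i hi
      simp [c, hi]

lemma exists_completion {B : Type} [CommRing B] (φ : S →+* B) (J : ℕ → Ideal S)
    (hJ : Antitone J) :
    ∃ (C : Type) (_ : CommRing C) (q : (ℕ → B) →+* C), Function.Surjective q ∧
      ∀ I : Ideal S, I.FG → ∀ b, q b ∈ I.map (q.comp (RingHom.pi fun _ => φ)) ↔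
        ∀ e, ∀ᶠ n in Filter.atTop, b n ∈ (I ⊔ J e).map φ := by
  classical
  let N : Ideal (ℕ → B) :=
    { carrier := {b | ∀ e, ∀ᶠ n in Filter.atTop, b n ∈ (J e).map φ}
      add_mem' := fun {a b} ha hb e => by
        filter_upwards [ha e, hb e] with n h1 h2
        exact Ideal.add_mem _ h1 h2
      zero_mem' := by simp
      smul_mem' := fun c b hb e => by
        filter_upwards [hb e] with n h
        exact Ideal.mul_mem_left _ _ h }
  refine ⟨_ ⧸ N, inferInstance, Ideal.Quotient.mk N, Ideal.Quotient.mk_surjective, ?_⟩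
  intro I hI b
  rw [← Ideal.map_map, Ideal.mem_quotient_iff_mem_sup, Submodule.mem_sup]
  constructor
  · rintro ⟨c, hc, e, he, rfl⟩ k
    filter_upwards [he k] with n hn
    rw [Ideal.map_sup]
    exact Submodule.add_mem_sup ((Ideal.mem_map_pi_iff (fun _ : ℕ => φ) hI).1 hc n) hn
  · intro h
    let P : ℕ → ℕ → Prop := fun n e => b n ∈ (I ⊔ J e).map φ
    let r : ℕ → ℕ := fun n => Nat.findGreatest (P n) n
    have hr : ∀ n, ∃ c ∈ I.map φ, P n (r n) → b n - c ∈ (J (r n)).map φ := by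
      intro n
      by_cases hP : P n (r n)
      · have hP' := hP
        simp only [P] at hP'
        rw [Ideal.map_sup, Submodule.mem_sup] at hP'
        obtain ⟨c, hc, e, he, hce⟩ := hP'
        exact ⟨c, hc, fun _ => by rw [← hce]; simpa using he⟩
      · exact ⟨0, Ideal.zero_mem _, fun h => absurd h hP⟩
    choose c hc hcb using hr
    refine ⟨c, (Ideal.mem_map_pi_iff (fun _ : ℕ => φ) hI).2 hc, b - c, ?_, by simp⟩
    change ∀ e, ∀ᶠ n in Filter.atTop, (b - c) n ∈ (J e).map φ
    intro e
    filter_upwards [h e, Filter.eventually_ge_atTop e] with n hn hen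
    exact Ideal.map_mono (hJ (Nat.le_findGreatest hen hn))
      (hcb n (Nat.findGreatest_spec (P := P n) hen hn))

lemma exists_sequentialColimit {B : ℕ → Type} [∀ n, CommRing (B n)] (φ : ∀ n, S →+* B n)
    (f : ∀ n, B n →+* B (n + 1)) (hf : ∀ n, (f n).comp (φ n) = φ (n + 1)) :
    ∃ (C : Type) (_ : CommRing C) (g : ∀ n, B n →+* C) (t : ∀ n m, n ≤ m → B n →+* B m),
      (∀ n, (g (n + 1)).comp (f n) = g n) ∧
      (∀ n m h, (g m).comp (t n m h) = g n) ∧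
      (∀ n m h, (t n m h).comp (φ n) = φ m) ∧
      (∀ c, ∃ n b, g n b = c) ∧
      (∀ (I : Ideal S) n b, g n b ∈ I.map ((g 0).comp (φ 0)) →
        ∃ m, ∃ h : n ≤ m, t n m h b ∈ I.map (φ m)) := by
  let t : ∀ n m, n ≤ m → B n →+* B m := fun n m h =>
    Nat.leRec (motive := fun m _ => B n →+* B m) (RingHom.id _) (fun {k} _ r => (f k).comp r) h
  have t_self : ∀ n, t n n le_rfl = RingHom.id _ := fun n => Nat.leRec_self _ _
  have t_succ : ∀ n m (h : n ≤ m), t n (m + 1) (h.trans m.le_succ) = (f m).comp (t n m h) :=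
    fun n m h => Nat.leRec_succ _ _ h
  have t_comp : ∀ n m k (h : n ≤ m) (h' : m ≤ k), (t m k h').comp (t n m h) = t n k (h.trans h') := by
    intro n m k h h'
    induction k, h' using Nat.le_induction with
    | base => rw [t_self]; rfl
    | succ k hk ih => rw [t_succ m k hk, t_succ n k (h.trans hk), ← ih, RingHom.comp_assoc]
  have t_φ : ∀ n m h, (t n m h).comp (φ n) = φ m := by
    intro n m h
    induction m, h using Nat.le_induction with
    | base => rw [t_self]; rfl
    | succ m hm ih => rw [t_succ n m hm, RingHom.comp_assoc, ih, hf]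
  have : DirectedSystem B fun i j h => t i j h :=
    { map_self := fun i x => by rw [t_self]; rfl
      map_map := fun k j i h h' x => RingHom.congr_fun (t_comp i j k h h') x }
  let g : ∀ n, B n →+* Ring.DirectLimit B (fun i j h => t i j h) :=
    fun n => Ring.DirectLimit.of B (fun i j h => t i j h) n
  have g_t : ∀ n m h, (g m).comp (t n m h) = g n :=
    fun n m h => RingHom.ext fun b => Ring.DirectLimit.of_f h b
  have surj : ∀ c, ∃ n b, g n b = c := fun c => Ring.DirectLimit.exists_of c
  have g_φ : ∀ n, (g n).comp (φ n) = (g 0).comp (φ 0) := by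
    intro n
    rw [← g_t 0 n n.zero_le, RingHom.comp_assoc, t_φ]
  have t_mem : ∀ (I : Ideal S) n m h b, b ∈ I.map (φ n) → t n m h b ∈ I.map (φ m) := by
    intro I n m h b hb
    have := Ideal.mem_map_of_mem (t n m h) hb
    rwa [Ideal.map_map, t_φ] at this
  refine ⟨_, inferInstance, g, t, fun n => ?_, g_t, t_φ, surj, ?_⟩
  · rw [← g_t n (n + 1) n.le_succ, t_succ n n le_rfl, t_self]; rfl
  intro I n b hb
  have key : ∀ c ∈ I.map ((g 0).comp (φ 0)), ∃ n, ∃ b ∈ I.map (φ n), g n b = c := by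
    intro c hc
    refine Submodule.span_induction ?_ ?_ ?_ ?_ hc
    · rintro _ ⟨s, hs, rfl⟩
      exact ⟨0, φ 0 s, Ideal.mem_map_of_mem _ hs, rfl⟩
    · exact ⟨0, 0, Ideal.zero_mem _, map_zero _⟩
    · rintro _ _ _ _ ⟨n, b, hb, rfl⟩ ⟨m, b', hb', rfl⟩
      refine ⟨max n m, t n _ (le_max_left n m) b + t m _ (le_max_right n m) b',
        Ideal.add_mem _ (t_mem _ _ _ _ _ hb) (t_mem _ _ _ _ _ hb'), ?_⟩
      rw [map_add, ← g_t n _ (le_max_left n m), ← g_t m _ (le_max_right n m)]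
      rfl
    · rintro a _ _ ⟨n, b, hb, rfl⟩
      obtain ⟨m, b', rfl⟩ := surj a
      refine ⟨max n m, t m _ (le_max_right n m) b' * t n _ (le_max_left n m) b,
        Ideal.mul_mem_left _ _ (t_mem _ _ _ _ _ hb), ?_⟩
      rw [map_mul, smul_eq_mul, ← g_t n _ (le_max_left n m), ← g_t m _ (le_max_right n m)]
      rfl
  obtain ⟨m, b', hb', hbb⟩ := key _ hb
  have hz : g (max n m) (t n _ (le_max_left n m) b - t m _ (le_max_right n m) b') = 0 := by
    rw [map_sub, sub_eq_zero]
    change ((g _).comp (t n _ _)) b = ((g _).comp (t m _ _)) b'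
    rw [g_t, g_t, hbb]
  obtain ⟨k, hk, hk0⟩ := Ring.DirectLimit.of.zero_exact (f' := t) hz
  refine ⟨k, (le_max_left n m).trans hk, ?_⟩
  rw [map_sub, sub_eq_zero] at hk0
  rw [← t_comp n _ k (le_max_left n m) hk, RingHom.comp_apply, hk0]
  exact t_mem _ _ _ _ _ (t_mem _ _ _ _ _ hb')

end Constructions

section CohenMacaulay

variable {S : Type*} [CommRing S]

lemma isCMwrt_iff {B : Type*} [CommRing B] {φ : S →+* B} {d : ℕ} {x : Fin d → S} :
    IsCMwrt φ x ↔ (∀ i, IsRegMod ((Ideal.span (x '' {j | j < i})).map φ) (φ (x i))) ∧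
      (Ideal.span (Set.range x)).map φ ≠ ⊤ := by
  simp only [IsCMwrt, IsRegSeq, IsRegMod, Ideal.map_span, Set.image_image, ← Set.range_comp]
  rfl

lemma isCMwrt_iff_isWeaklyRegMod {B : Type*} [CommRing B] {φ : S →+* B} {d : ℕ} {x : Fin d → S} :
    IsCMwrt φ x ↔ IsWeaklyRegMod ⊥ ((List.ofFn x).map φ) ∧
      (Ideal.span (Set.range x)).map φ ≠ ⊤ := by
  rw [isCMwrt_iff, List.map_ofFn, isWeaklyRegMod_ofFn]
  simp only [bot_sup_eq, Ideal.map_span, Set.image_image, Function.comp_apply]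

lemma fg_span_of_fintype {d : ℕ} (x : Fin d → S) (s : Set (Fin d)) :
    (Ideal.span (x '' s)).FG :=
  Submodule.fg_span (Set.toFinite _)

lemma fg_span_range_of_fintype {d : ℕ} (x : Fin d → S) : (Ideal.span (Set.range x)).FG :=
  Submodule.fg_span (Set.toFinite _)

/-- Regularity passes to a reduced product. -/
lemma isCMwrt_reducedProduct {ι : Type} {B : ι → Type} [∀ i, CommRing (B i)] {F : Filter ι}
    [F.NeBot] {φ : ∀ i, S →+* B i} {C : Type} [CommRing C] {q : (∀ i, B i) →+* C}
    (hq : Function.Surjective q)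
    (hmem : ∀ I : Ideal S, I.FG → ∀ b, q b ∈ I.map (q.comp (RingHom.pi φ)) ↔
        ∀ᶠ i in F, b i ∈ I.map (φ i))
    {d : ℕ} {x : Fin d → S} (h : ∀ i, IsCMwrt (φ i) x) :
    IsCMwrt (q.comp (RingHom.pi φ)) x := by
  simp only [isCMwrt_iff] at h ⊢
  refine ⟨fun j c hc => ?_, fun htop => ?_⟩
  · obtain ⟨b, rfl⟩ := hq c
    rw [RingHom.comp_apply, ← map_mul, hmem _ (fg_span_of_fintype x _)] at hc
    rw [hmem _ (fg_span_of_fintype x _)]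
    filter_upwards [hc] with i hi
    exact (h i).1 j _ hi
  · rw [Ideal.eq_top_iff_one, ← map_one q, hmem _ (fg_span_range_of_fintype x)] at htop
    obtain ⟨i, hi⟩ := htop.exists
    exact (h i).2 ((Ideal.eq_top_iff_one _).2 hi)

/-- Regularity passes to a sequential colimit. -/
lemma isCMwrt_sequentialColimit {B : ℕ → Type} [∀ n, CommRing (B n)] {φ : ∀ n, S →+* B n}
    {C : Type} [CommRing C] {g : ∀ n, B n →+* C} {t : ∀ n m, n ≤ m → B n →+* B m}
    (gt : ∀ n m h, (g m).comp (t n m h) = g n)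
    (tφ : ∀ n m h, (t n m h).comp (φ n) = φ m)
    (surj : ∀ c, ∃ n b, g n b = c)
    (hmem : ∀ (I : Ideal S) n b, g n b ∈ I.map ((g 0).comp (φ 0)) →
        ∃ m, ∃ h : n ≤ m, t n m h b ∈ I.map (φ m))
    {d : ℕ} {x : Fin d → S} (h : ∀ n, IsCMwrt (φ n) x) :
    IsCMwrt ((g 0).comp (φ 0)) x := by
  have gφ : ∀ n, (g n).comp (φ n) = (g 0).comp (φ 0) := by
    intro n
    rw [← gt 0 n n.zero_le, RingHom.comp_assoc, tφ]
  simp only [isCMwrt_iff] at h ⊢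
  refine ⟨fun j c hc => ?_, fun htop => ?_⟩
  · obtain ⟨n, b, rfl⟩ := surj c
    rw [← gφ n, RingHom.comp_apply, ← map_mul, gφ n] at hc
    obtain ⟨m, hnm, hm⟩ := hmem _ _ _ hc
    rw [map_mul, ← RingHom.comp_apply, tφ] at hm
    have := Ideal.mem_map_of_mem (g m) ((h m).1 j _ hm)
    rwa [Ideal.map_map, gφ, ← RingHom.comp_apply, gt] at this
  · rw [Ideal.eq_top_iff_one, ← map_one (g 0)] at htop
    obtain ⟨m, hnm, hm⟩ := hmem _ _ _ htop
    rw [map_one] at hm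
    exact (h m).2 ((Ideal.eq_top_iff_one _).2 hm)

lemma root_pow {B : Type*} [CommRing B] {p : ℕ} {π : ℕ → B} (hπ : ∀ e, π (e + 1) ^ p = π e)
    (n s : ℕ) : π (n + s) ^ p ^ s = π n := by
  induction s with
  | zero => simp
  | succ s ih => rw [pow_succ', pow_mul, ← add_assoc, hπ, ih]

/-- An almost Cohen-Macaulay algebra `B` maps to an algebra that is Cohen-Macaulay with respect to
the same sequence, namely the localization of `B ^ ℕ` at the sequence of roots. -/
lemma IsAlmostCMwrt.exists_isCMwrt {p : ℕ} (hp : p.Prime) {B : Type} [CommRing B] {φ : S →+* B}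
    {π : ℕ → B} (hπ : ∀ e, π (e + 1) ^ p = π e) {d : ℕ} {x : Fin d → S}
    (h : IsAlmostCMwrt φ π x) :
    ∃ (C : Type) (_ : CommRing C) (g : B →+* C), IsCMwrt (g.comp φ) x ∧
      ∀ b, (∀ e, π e * b = 0) → g b = 0 := by
  let T := ℕ → B
  let w : T := π
  let L := Localization.Away w
  let g : B →+* L := (algebraMap T L).comp (RingHom.pi fun _ => RingHom.id B)
  let ψ : S →+* T := RingHom.pi fun _ => φ
  have hg : g.comp φ = (algebraMap T L).comp ψ := rfl
  have hmem : ∀ I : Ideal S, I.FG → ∀ t : T, algebraMap T L t ∈ I.map (g.comp φ) ↔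
      ∃ k : ℕ, ∀ n, π n ^ k * t n ∈ I.map φ := by
    intro I hI t
    rw [hg, ← Ideal.map_map,
      IsLocalization.algebraMap_mem_map_algebraMap_iff (Submonoid.powers w)]
    constructor
    · rintro ⟨_, ⟨k, rfl⟩, hk⟩
      exact ⟨k, (Ideal.mem_map_pi_iff (fun _ : ℕ => φ) hI).1 hk⟩
    · rintro ⟨k, hk⟩
      exact ⟨w ^ k, ⟨k, rfl⟩, (Ideal.mem_map_pi_iff (fun _ : ℕ => φ) hI).2 hk⟩
  have hinit : ∀ i, Ideal.span ((fun j => φ (x j)) '' {j | j < i}) =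
      (Ideal.span (x '' {j | j < i})).map φ := by
    intro i
    rw [Ideal.map_span, Set.image_image]
  have hrange : Ideal.span (Set.range fun j => φ (x j)) = (Ideal.span (Set.range x)).map φ := by
    rw [Ideal.map_span, ← Set.range_comp]; rfl
  refine ⟨L, inferInstance, g, isCMwrt_iff.2 ⟨fun i c hc => ?_, fun htop => ?_⟩, fun b hb => ?_⟩
  · obtain ⟨⟨t, s⟩, hts⟩ := IsLocalization.surj (Submonoid.powers w) c
    have hs : IsUnit (algebraMap T L s) := IsLocalization.map_units L s
    rw [← Ideal.mul_unit_mem_iff_mem _ hs, hts, hmem _ (fg_span_of_fintype x _)]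
    rw [← Ideal.mul_unit_mem_iff_mem _ hs, mul_assoc, hts, hg, RingHom.comp_apply, ← map_mul,
      ← hg, hmem _ (fg_span_of_fintype x _)] at hc
    obtain ⟨k, hk⟩ := hc
    refine ⟨k + 1, fun n => ?_⟩
    rw [← hinit, pow_succ', mul_assoc]
    refine h.1 i _ ?_ n
    rw [hinit]
    have h2 : φ (x i) * (π n ^ k * t n) = π n ^ k * (φ (x i) * t n) := by ring
    rw [h2]
    exact hk n
  · rw [Ideal.eq_top_iff_one, ← map_one (algebraMap T L),
      hmem _ (fg_span_range_of_fintype x)] at htop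
    obtain ⟨k, hk⟩ := htop
    refine h.2 (Ideal.span_le.2 ?_)
    rintro _ ⟨n, rfl⟩
    have hkp : k ≤ p ^ k := (Nat.lt_pow_self hp.one_lt).le
    have := hk (n + k)
    rw [Pi.one_apply, mul_one, ← hrange] at this
    rw [SetLike.mem_coe, ← root_pow hπ n k, ← Nat.sub_add_cancel hkp, pow_add]
    exact Ideal.mul_mem_left _ _ this
  · have h0 := (hmem ⊥ Submodule.fg_bot (fun _ => b)).2
    rw [Ideal.map_bot, Ideal.map_bot] at h0
    exact h0 ⟨1, fun n => by simpa using hb n⟩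

end CohenMacaulay

section Perfect

variable {S : Type} [CommRing S]

lemma charP_of_ringHom {p : ℕ} (hp : p.Prime) [CharP S p] {B : Type*} [CommRing B] [Nontrivial B]
    (φ : S →+* B) : CharP B p :=
  (CharP.charP_iff_prime_eq_zero hp).2 (by rw [← map_natCast φ, CharP.cast_eq_zero, map_zero])

lemma IsCMwrt.nontrivial {B : Type*} [CommRing B] {φ : S →+* B} {d : ℕ} {x : Fin d → S}
    (h : IsCMwrt φ x) : Nontrivial B :=
  ⟨0, 1, fun h01 => h.2 ((Ideal.eq_top_iff_one _).2 (h01 ▸ Ideal.zero_mem _))⟩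

lemma injective_pow_char {p : ℕ} (hp : p.Prime) {B : Type*} [CommRing B] [CharP B p]
    (h : ∀ b : B, b ^ p = 0 → b = 0) : Function.Injective fun b : B => b ^ p := by
  have : Fact p.Prime := ⟨hp⟩
  exact (injective_iff_map_eq_zero (frobenius B p)).2 h

lemma IsCMwrt.iterateFrobenius_comp {p : ℕ} (hp : p.Prime) {B : Type*} [CommRing B] [CharP B p]
    [Fact p.Prime] {φ : S →+* B} {d : ℕ} {x : Fin d → S} (h : IsCMwrt φ x) (n : ℕ) :
    IsCMwrt ((iterateFrobenius B p n).comp φ) x := by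
  rw [isCMwrt_iff_isWeaklyRegMod] at h ⊢
  have hpos : 0 < p ^ n := pow_pos hp.pos n
  constructor
  · have := h.1.pow_entries hpos
    rwa [List.map_map] at this
  · refine fun htop => h.2 (top_le_iff.1 (htop ▸ Ideal.map_le_iff_le_comap.2 fun s hs => ?_))
    exact Ideal.pow_mem_of_mem _ (Ideal.mem_map_of_mem φ hs) _ hpos

lemma IsCMwrt.exists_perfect {p : ℕ} (hp : p.Prime) [CharP S p] {B : Type} [CommRing B]
    {φ : S →+* B} {d : ℕ} {x : Fin d → S} (h : IsCMwrt φ x) :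
    ∃ (C : Type) (_ : CommRing C) (g : B →+* C), IsCMwrt (g.comp φ) x ∧
      Function.Bijective fun c : C => c ^ p := by
  have : Fact p.Prime := ⟨hp⟩
  have := h.nontrivial
  have := charP_of_ringHom hp φ
  have hf : ∀ n, (frobenius B p).comp ((iterateFrobenius B p n).comp φ) =
      (iterateFrobenius B p (n + 1)).comp φ := by
    intro n
    ext s
    simp [frobenius_def, iterateFrobenius_def, pow_succ, pow_mul]
  obtain ⟨C, _, g, t, gf, gt, tφ, surj, hmem⟩ := exists_sequentialColimit
    (fun n => (iterateFrobenius B p n).comp φ) (fun _ => frobenius B p) hf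
  have hC := isCMwrt_sequentialColimit gt tφ surj hmem fun n => h.iterateFrobenius_comp hp n
  have h0 : (g 0).comp ((iterateFrobenius B p 0).comp φ) = (g 0).comp φ := by
    ext s; simp
  rw [h0] at hC
  refine ⟨C, _, g 0, hC, ?_, fun c => ?_⟩
  · have := hC.nontrivial
    have := charP_of_ringHom hp ((g 0).comp φ)
    refine injective_pow_char hp fun c hc => ?_
    obtain ⟨n, b, rfl⟩ := surj c
    have h1 : g n (b ^ p) ∈ (⊥ : Ideal S).map ((g 0).comp ((iterateFrobenius B p 0).comp φ)) := by
      rw [map_pow, hc]; exact Ideal.zero_mem _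
    obtain ⟨m, hnm, hm⟩ := hmem _ _ _ h1
    rw [Ideal.map_bot, Ideal.mem_bot, map_pow] at hm
    rw [← gt n m hnm, ← gf m]
    simp [frobenius_def, hm]
  · obtain ⟨n, b, rfl⟩ := surj c
    refine ⟨g (n + 1) b, ?_⟩
    rw [← gf n]
    simp [frobenius_def]

lemma mem_map_span_pow_of_pow_mem {p : ℕ} (hp : p.Prime) {B : Type*} [CommRing B] [CharP B p]
    (hB : Function.Bijective fun b : B => b ^ p) {φ : S →+* B} {d : ℕ} {x : Fin d → S} {e : ℕ}
    {b : B} (hb : b ^ p ∈ (Ideal.span (Set.range fun i => x i ^ p ^ (e + 1))).map φ) :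
    b ∈ (Ideal.span (Set.range fun i => x i ^ p ^ e)).map φ := by
  have : Fact p.Prime := ⟨hp⟩
  rw [Ideal.map_span, ← Set.range_comp, Ideal.mem_span_range_iff_exists_fun] at hb ⊢
  obtain ⟨c, hc⟩ := hb
  choose r hr using hB.2
  refine ⟨fun i => r (c i), hB.1 ?_⟩
  change (∑ i, _) ^ p = b ^ p
  rw [sum_pow_char, ← hc]
  refine Finset.sum_congr rfl fun i _ => ?_
  have := hr (c i)
  simp only at this
  simp [mul_pow, this, pow_succ, pow_mul]

end Perfect

section Completion

open Ideal

lemma List.exists_ofFn_eq_append {B : Type*} {d : ℕ} (y : Fin d → B) (i : Fin d) :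
    ∃ l₁ l₂ : List B, List.ofFn y = l₁ ++ y i :: l₂ ∧ ∀ b, b ∈ l₁ ↔ ∃ j < i, y j = b := by
  refine ⟨(List.ofFn y).take i, (List.ofFn y).drop (i + 1), ?_, fun b => ?_⟩
  · have h : (i : ℕ) < (List.ofFn y).length := by simp
    conv_lhs => rw [← List.take_append_drop i (List.ofFn y), ← List.getElem_cons_drop h]
    simp
  · rw [List.mem_take_iff_getElem]
    constructor
    · rintro ⟨j, hj, rfl⟩
      have : j < i := by omega
      exact ⟨⟨j, this.trans i.2⟩, this, by simp⟩
    · rintro ⟨j, hj, rfl⟩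
      exact ⟨j, by simpa using hj, by simp⟩

lemma IsWeaklyRegMod.mem_of_mul_mem {B : Type*} [CommRing B] {d : ℕ} {y : Fin d → B}
    (h : IsWeaklyRegMod ⊥ (List.ofFn y)) (i : Fin d) (n : ℕ) {b : B}
    (hb : y i * b ∈ span (y '' {j | j < i}) ⊔ span (Set.range fun j => y j ^ (n + 1))) :
    b ∈ span (y '' {j | j < i}) ⊔ span (Set.range fun j => y j ^ n) := by
  obtain ⟨l₁, l₂, hl, hl₁⟩ := List.exists_ofFn_eq_append y i
  have hK : span (y '' {j | j < i}) = Ideal.ofList l₁ := by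
    rw [Ideal.ofList]
    congr 1
    ext b
    simp [hl₁]
  have hmem : ∀ b, (∃ j, y j = b) ↔ b ∈ l₁ ∨ b = y i ∨ b ∈ l₂ := by
    intro b
    rw [← List.mem_cons, ← List.mem_append, ← hl, List.mem_ofFn]
  rw [hK] at hb ⊢
  rw [hl, isWeaklyRegMod_append, bot_sup_eq] at h
  have hreg := IsWeaklyRegMod.head_sup_tail
    (I := Ideal.ofList l₁) (r := y i) (l := l₂.map (· ^ (n + 1)))
    ⟨h.2.1, h.2.2.pow_entries n.succ_pos⟩
  have hle : Ideal.ofList l₁ ⊔ span (Set.range fun j => y j ^ (n + 1)) ≤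
      Ideal.ofList l₁ ⊔ Ideal.ofList (l₂.map (· ^ (n + 1))) ⊔ span {y i ^ (n + 1)} := by
    refine sup_le (le_sup_left.trans le_sup_left) (span_le.2 ?_)
    rintro _ ⟨j, rfl⟩
    rcases (hmem (y j)).1 ⟨j, rfl⟩ with hj | hj | hj
    · exact Ideal.mem_sup_left (Ideal.mem_sup_left
        (Ideal.pow_mem_of_mem _ (subset_span (s := {b | b ∈ l₁}) hj) _ n.succ_pos))
    · simp only [hj]
      exact Ideal.mem_sup_right (mem_span_singleton_self _)
    · exact Ideal.mem_sup_left (Ideal.mem_sup_right (subset_span (List.mem_map_of_mem hj)))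
  obtain ⟨c, hc⟩ := Ideal.mem_sup_span_singleton_iff.1 (hle hb)
  have hge : Ideal.ofList l₁ ⊔ Ideal.ofList (l₂.map (· ^ (n + 1))) ≤
      Ideal.ofList l₁ ⊔ span (Set.range fun j => y j ^ n) := by
    refine sup_le_sup_left (span_le.2 ?_) _
    intro b hb
    obtain ⟨a, ha, rfl⟩ := List.mem_map.1 hb
    obtain ⟨j, rfl⟩ := (hmem a).2 (Or.inr (Or.inr ha))
    simp only [pow_succ]
    exact Ideal.mul_mem_right _ _ (subset_span ⟨j, rfl⟩)
  have h1 : b - y i ^ n * c ∈ Ideal.ofList l₁ ⊔ Ideal.ofList (l₂.map (· ^ (n + 1))) := by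
    refine hreg _ ?_
    convert hc using 1
    ring
  rw [← sub_add_cancel b (y i ^ n * c)]
  exact Ideal.add_mem _ (hge h1)
    (Ideal.mul_mem_right _ _ (Ideal.mem_sup_right (subset_span ⟨i, rfl⟩)))

/-- The ideal generated by the `p ^ e`-th powers of the sequence `x`. -/
def frobeniusPowerIdeal {S : Type*} [CommRing S] (p : ℕ) {d : ℕ} (x : Fin d → S) (e : ℕ) :
    Ideal S :=
  span (Set.range fun i => x i ^ p ^ e)

variable {S : Type} [CommRing S] {d : ℕ} {x : Fin d → S} {p : ℕ}

lemma frobeniusPowerIdeal_fg (e : ℕ) : (frobeniusPowerIdeal p x e).FG :=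
  fg_span_range_of_fintype _

lemma frobeniusPowerIdeal_antitone (hp : p.Prime) : Antitone (frobeniusPowerIdeal p x) := by
  intro e f hef
  refine span_le.2 ?_
  rintro _ ⟨i, rfl⟩
  obtain ⟨c, hc⟩ := pow_dvd_pow (x i) (Nat.pow_le_pow_right hp.pos hef)
  simp only [hc]
  exact Ideal.mul_mem_right _ _ (subset_span ⟨i, rfl⟩)

lemma frobeniusPowerIdeal_le (hp : p.Prime) (e : ℕ) :
    frobeniusPowerIdeal p x e ≤ span (Set.range x) := by
  have := frobeniusPowerIdeal_antitone (x := x) hp e.zero_le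
  simpa [frobeniusPowerIdeal] using this

lemma le_radical_frobeniusPowerIdeal (e : ℕ) :
    span (Set.range x) ≤ (frobeniusPowerIdeal p x e).radical := by
  refine span_le.2 ?_
  rintro _ ⟨i, rfl⟩
  exact ⟨p ^ e, subset_span ⟨i, rfl⟩⟩

lemma IsCMwrt.mem_map_sup_of_mul_mem (hp : p.Prime) {B : Type*} [CommRing B] {φ : S →+* B}
    (h : IsCMwrt φ x) (i : Fin d) (e : ℕ) {b : B}
    (hb : φ (x i) * b ∈ (span (x '' {j | j < i}) ⊔ frobeniusPowerIdeal p x (e + 1)).map φ) :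
    b ∈ (span (x '' {j | j < i}) ⊔ frobeniusPowerIdeal p x e).map φ := by
  have hle : frobeniusPowerIdeal p x (e + 1) ≤ span (Set.range fun j => x j ^ (p ^ e + 1)) := by
    refine span_le.2 ?_
    rintro _ ⟨j, rfl⟩
    have hpe : p ^ e + 1 ≤ p ^ (e + 1) := Nat.pow_lt_pow_right hp.one_lt e.lt_succ_self
    obtain ⟨c, hc⟩ := pow_dvd_pow (x j) hpe
    simp only [hc]
    exact Ideal.mul_mem_right _ _ (subset_span ⟨j, rfl⟩)
  have hb' := Ideal.map_mono (f := φ) (sup_le_sup_left hle _) hb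
  rw [isCMwrt_iff_isWeaklyRegMod, List.map_ofFn] at h
  have key := h.1.mem_of_mul_mem i (p ^ e) (b := b)
  simp only [frobeniusPowerIdeal, Ideal.map_sup, Ideal.map_span, Set.image_image,
    ← Set.range_comp, Function.comp_def, map_pow] at hb' key ⊢
  exact key hb'

/-- Perfect big Cohen-Macaulay algebras that are separated for the topology defined by `x`. -/
structure IsSeparatedPerfectBigCM [IsLocalRing S] (p : ℕ) {B : Type*} [CommRing B] (φ : S →+* B)
    {d : ℕ} (x : Fin d → S) : Prop where
  perfect : Function.Bijective fun b : B => b ^ p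
  isBigCM : IsBigCM φ
  separated : ∀ b, (∀ e, b ∈ (frobeniusPowerIdeal p x e).map φ) → b = 0

lemma IsSOP.map_span_ne_top [IsNoetherianRing S] [IsLocalRing S] {d' : ℕ} {y : Fin d' → S}
    (hx : IsSOP S x) (hy : IsSOP S y) {B : Type*} [CommRing B] {φ : S →+* B}
    (h : (span (Set.range x)).map φ ≠ ⊤) : (span (Set.range y)).map φ ≠ ⊤ := by
  intro htop
  have hle : span (Set.range y) ≤ (span (Set.range x)).radical := by
    rw [hx.2.2, ← hy.2.2]
    exact Ideal.le_radical
  obtain ⟨n, hn⟩ := Ideal.exists_pow_le_of_le_radical_of_fg hle (fg_span_range_of_fintype y)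
  have := Ideal.map_mono (f := φ) hn
  rw [Ideal.map_pow, htop, Ideal.top_pow, top_le_iff] at this
  exact h this

lemma IsCMwrt.isBigCM [IsNoetherianRing S] [IsLocalRing S] {B : Type} [CommRing B] {φ : S →+* B}
    (hx : IsSOP S x) (h : IsCMwrt φ x)
    (hbot : IsChainFree (φ '' IsLocalRing.maximalIdeal S) (⊥ : Ideal B))
    (hsup : ∀ I : Ideal B, IsChainFree (φ '' IsLocalRing.maximalIdeal S) I →
      ∀ a ∈ φ '' IsLocalRing.maximalIdeal S,
        IsChainFree (φ '' IsLocalRing.maximalIdeal S) (I ⊔ span {a})) : IsBigCM φ := by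
  intro d' y hy
  obtain rfl : d' = d := by
    have := hy.1.trans hx.1.symm
    exact_mod_cast this
  have hht := IsLocalRing.maximalIdeal_height_eq_ringKrullDim (R := S)
  rw [isCMwrt_iff_isWeaklyRegMod] at h ⊢
  refine ⟨?_, hx.map_span_ne_top hy h.2⟩
  have hofList : ∀ w : Fin d' → S, Ideal.ofList (List.ofFn w) = span (Set.range w) := by
    intro w
    rw [Ideal.ofList]
    congr 1
    ext; simp [List.mem_ofFn]
  have := IsWeaklyRegMod.of_systemOfParameters φ hbot hsup (l₁ := List.ofFn x)
    (l₂ := List.ofFn y) (z := []) (by simp) ?_ (by simpa [hofList] using hx.2.2)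
    (by simpa [hofList] using hy.2.2) (by simpa using h.1)
  · simpa using this
  · have h2 := hx.1.trans hht.symm
    simp only [List.append_nil, List.length_ofFn]
    exact_mod_cast h2

lemma isChainFree_sup_span_singleton {B : Type*} [CommRing B] {M : Set B}
    (hsolve : ∀ a ∈ M, ∀ m : ℕ → B, ∃ v : ℕ → B, ∀ n, m n = v n - a * v (n + 1)) {I : Ideal B}
    (hI : IsChainFree M I) (g : B) : IsChainFree M (I ⊔ span {g}) := by
  intro a ha u hu
  choose m hm using fun n => Ideal.mem_sup_span_singleton_iff.1 (hu n)
  obtain ⟨v, hv⟩ := hsolve a ha m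
  intro n
  refine Ideal.mem_sup_span_singleton_iff.2 ⟨v n, ?_⟩
  refine hI a ha (fun n => u n - g * v n) (fun n => ?_) n
  convert hm n using 1
  rw [hv n]
  ring

end Completion

section Good

open Ideal Filter

variable {S : Type} [CommRing S] {d : ℕ} {x : Fin d → S} {p : ℕ}

/-- The completion of a perfect Cohen-Macaulay algebra is a separated perfect big Cohen-Macaulay
algebra. -/
lemma IsCMwrt.exists_isSeparatedPerfectBigCM_of_perfect [IsNoetherianRing S] [IsLocalRing S]
    (hp : p.Prime) [CharP S p] (hx : IsSOP S x) {B : Type} [CommRing B] {φ : S →+* B}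
    (h : IsCMwrt φ x) (hB : Function.Bijective fun b : B => b ^ p) :
    ∃ (C : Type) (_ : CommRing C) (f : B →+* C), IsSeparatedPerfectBigCM p (f.comp φ) x := by
  obtain ⟨C, _, q, hq, hmem⟩ := exists_completion φ (frobeniusPowerIdeal p x)
    (frobeniusPowerIdeal_antitone hp)
  have hchar : CharP B p := have := h.nontrivial; charP_of_ringHom hp φ
  let ψ : S →+* C := q.comp (RingHom.pi fun _ => φ)
  have hψ : ∀ s, ψ s = q (fun _ => φ s) := fun _ => rfl
  have hzero : ∀ b, q b = 0 ↔ ∀ e, ∀ᶠ n in atTop, b n ∈ (frobeniusPowerIdeal p x e).map φ := by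
    intro b
    have := hmem ⊥ Submodule.fg_bot b
    simpa using this
  have hCM : IsCMwrt ψ x := by
    refine isCMwrt_iff.2 ⟨fun i c hc => ?_, fun htop => ?_⟩
    · obtain ⟨b, rfl⟩ := hq c
      rw [hψ, ← map_mul, hmem _ (fg_span_of_fintype x _)] at hc
      refine (hmem _ (fg_span_of_fintype x _) _).2 fun e => ?_
      filter_upwards [hc (e + 1)] with n hn
      exact h.mem_map_sup_of_mul_mem hp i e hn
    · rw [Ideal.eq_top_iff_one, ← map_one q, hmem _ (fg_span_range_of_fintype x)] at htop
      obtain ⟨n, hn⟩ := (htop 0).exists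
      rw [sup_eq_left.2 (frobeniusPowerIdeal_le hp 0), Pi.one_apply, ← Ideal.eq_top_iff_one] at hn
      exact (isCMwrt_iff.1 h).2 hn
  have hsep : ∀ c, (∀ e, c ∈ (frobeniusPowerIdeal p x e).map ψ) → c = 0 := by
    intro c hc
    obtain ⟨b, rfl⟩ := hq c
    refine (hzero b).2 fun e => ?_
    have := (hmem _ (frobeniusPowerIdeal_fg e) b).1 (hc e) e
    rwa [sup_idem] at this
  have hperf : Function.Bijective fun c : C => c ^ p := by
    refine ⟨?_, fun c => ?_⟩
    · have := hCM.nontrivial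
      have := charP_of_ringHom hp ψ
      refine injective_pow_char hp fun c hc => ?_
      obtain ⟨b, rfl⟩ := hq c
      rw [← map_pow, hzero] at hc
      refine (hzero b).2 fun e => ?_
      filter_upwards [hc (e + 1)] with n hn
      exact mem_map_span_pow_of_pow_mem hp hB hn
    · obtain ⟨b, rfl⟩ := hq c
      choose r hr using hB.2
      refine ⟨q fun n => r (b n), ?_⟩
      simp only [← map_pow]
      congr 1
      funext n
      exact hr (b n)
  have hnil : ∀ s ∈ IsLocalRing.maximalIdeal S, ∀ e, ∃ k, s ^ k ∈ frobeniusPowerIdeal p x e := by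
    intro s hs e
    rw [← hx.2.2] at hs
    have := Ideal.radical_mono (le_radical_frobeniusPowerIdeal (x := x) (p := p) e) hs
    rwa [Ideal.radical_idem] at this
  refine ⟨C, _, q.comp (RingHom.pi fun _ => RingHom.id B), hperf, hCM.isBigCM hx ?_ ?_, hsep⟩
  · rintro _ ⟨s, hs, rfl⟩ u hu
    have hu' : ∀ k n, u n = ψ s ^ k * u (n + k) := by
      intro k
      induction k with
      | zero => simp
      | succ k ih =>
        intro n
        rw [ih n, pow_succ, mul_assoc, ← add_assoc, sub_eq_zero.1 ((Ideal.mem_bot).1 (hu (n + k)))]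
        rfl
    intro n
    refine (Ideal.mem_bot).2 (hsep _ fun e => ?_)
    obtain ⟨k, hk⟩ := hnil s hs e
    rw [hu' k n, ← map_pow]
    exact Ideal.mul_mem_right _ _ (Ideal.mem_map_of_mem ψ hk)
  · intro I hI g _
    refine isChainFree_sup_span_singleton ?_ hI g
    rintro _ ⟨s, hs, rfl⟩ m
    choose b hb using fun k => hq (m k)
    let v : ℕ → ℕ → B := fun k n => ∑ j ∈ Finset.range n, φ s ^ j * b (k + j) n
    refine ⟨fun k => q (v k), fun k => ?_⟩
    change m k = q (v k) - ψ s * q (v (k + 1))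
    rw [← hb, hψ, ← map_mul, ← map_sub, ← sub_eq_zero, ← map_sub, hzero]
    intro e
    obtain ⟨N, hN⟩ := hnil s hs e
    filter_upwards [eventually_ge_atTop N] with n hn
    have key : (b k - (v k - (fun _ => φ s) * v (k + 1)) : ℕ → B) n = φ s ^ n * b (k + n) n := by
      have h1 := Finset.sum_range_succ (fun j => φ s ^ j * b (k + j) n) n
      rw [Finset.sum_range_succ'] at h1
      simp only [Pi.sub_apply, Pi.mul_apply, v, Finset.mul_sum]
      have h2 : ∀ j, φ s * (φ s ^ j * b (k + 1 + j) n) = φ s ^ (j + 1) * b (k + (j + 1)) n := by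
        intro j
        rw [pow_succ', mul_assoc, add_right_comm, add_assoc]
      simp only [h2]
      simp only [pow_zero, one_mul, add_zero] at h1
      linear_combination h1
    rw [key]
    refine Ideal.mul_mem_right _ _ ?_
    obtain ⟨r, rfl⟩ := Nat.exists_eq_add_of_le hn
    rw [pow_add, ← map_pow]
    exact Ideal.mul_mem_right _ _ (Ideal.mem_map_of_mem φ hN)

lemma IsCMwrt.exists_isSeparatedPerfectBigCM [IsNoetherianRing S] [IsLocalRing S]
    (hp : p.Prime) [CharP S p] (hx : IsSOP S x) {B : Type} [CommRing B] {φ : S →+* B}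
    (h : IsCMwrt φ x) :
    ∃ (C : Type) (_ : CommRing C) (f : B →+* C), IsSeparatedPerfectBigCM p (f.comp φ) x := by
  obtain ⟨P, _, g, hP, hperf⟩ := h.exists_perfect hp
  obtain ⟨C, _, f, hf⟩ := hP.exists_isSeparatedPerfectBigCM_of_perfect hp hx hperf
  exact ⟨C, _, f.comp g, hf⟩

lemma eq_zero_of_pow_eq_zero_of_perfect (hp : p.Prime) {B : Type*} [CommRing B]
    (hB : Function.Bijective fun b : B => b ^ p) {b : B} {e : ℕ} (h : b ^ p ^ e = 0) : b = 0 := by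
  induction e with
  | zero => simpa using h
  | succ e ih =>
    refine ih (hB.1 ?_)
    change (b ^ p ^ e) ^ p = 0 ^ p
    rw [← pow_mul, ← pow_succ, h, zero_pow hp.ne_zero]

lemma pow_mem_map_frobeniusPowerIdeal (hp : p.Prime) {B : Type*} [CommRing B] [CharP B p]
    {φ : S →+* B} (e : ℕ) {b : B} (hb : b ∈ span (Set.range fun i => φ (x i))) :
    b ^ p ^ e ∈ (frobeniusPowerIdeal p x e).map φ := by
  have : Fact p.Prime := ⟨hp⟩
  obtain ⟨c, rfl⟩ := Ideal.mem_span_range_iff_exists_fun.1 hb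
  rw [sum_pow_char_pow]
  refine Ideal.sum_mem _ fun i _ => ?_
  rw [mul_pow, ← map_pow]
  exact Ideal.mul_mem_left _ _ (Ideal.mem_map_of_mem φ (subset_span ⟨i, rfl⟩))

/-- A nonzero element of a separated perfect big Cohen-Macaulay algebra can be made regular:
its annihilator dies in another Cohen-Macaulay algebra. -/
lemma IsSeparatedPerfectBigCM.exists_isCMwrt_of_mul_eq_zero [IsLocalRing S] (hp : p.Prime)
    [CharP S p] (hx : IsSOP S x) {B : Type} [CommRing B] {φ : S →+* B} (h : IsSeparatedPerfectBigCM p φ x)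
    {a : B} (ha : a ≠ 0) :
    ∃ (C : Type) (_ : CommRing C) (g : B →+* C), IsCMwrt (g.comp φ) x ∧
      ∀ b, a * b = 0 → g b = 0 := by
  choose r hr using h.perfect.2
  simp only at hr
  let π : ℕ → B := fun e => r^[e] a
  have hπ : ∀ e, π (e + 1) ^ p = π e := by
    intro e
    simp only [π, Function.iterate_succ_apply', hr]
  have hπa : ∀ e, π e ^ p ^ e = a := fun e => by simpa [π] using root_pow hπ 0 e
  have hCM := h.isBigCM d x hx
  have hACM : IsAlmostCMwrt φ π x := by
    refine ⟨fun i b hb e => Ideal.mul_mem_left _ _ (hCM.1 i b hb), fun hle => ha ?_⟩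
    refine h.separated a fun e => ?_
    have := hCM.nontrivial
    have := charP_of_ringHom hp φ
    rw [← hπa e]
    exact pow_mem_map_frobeniusPowerIdeal hp e (hle (subset_span ⟨e, rfl⟩))
  obtain ⟨C, _, g, hg, hg0⟩ := hACM.exists_isCMwrt hp hπ
  refine ⟨C, _, g, hg, fun b hb => hg0 b fun e => ?_⟩
  refine eq_zero_of_pow_eq_zero_of_perfect hp h.perfect (e := e) ?_
  have hpos : p ^ e ≠ 0 := (pow_pos hp.pos e).ne'
  rw [mul_pow, hπa]
  obtain ⟨n, hn⟩ := Nat.exists_eq_succ_of_ne_zero hpos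
  rw [hn, pow_succ', ← mul_assoc, hb, zero_mul]

end Good

section Domain

open Filter

/-- Along a chain of kernels of maps to Cohen-Macaulay algebras, a reduced product gives an upper
bound. -/
lemma exists_isCMwrt_forall_le_ker {S : Type} [CommRing S] {d : ℕ} {x : Fin d → S}
    {B : Type} [CommRing B] {φ : S →+* B} {c : Set (Ideal B)}
    (hc : IsChain (· ≤ ·) c) (hne : c.Nonempty)
    (h : ∀ I ∈ c, ∃ (C : Type) (_ : CommRing C) (f : B →+* C),
      IsCMwrt (f.comp φ) x ∧ I ≤ RingHom.ker f) :
    ∃ (C : Type) (_ : CommRing C) (f : B →+* C),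
      IsCMwrt (f.comp φ) x ∧ ∀ I ∈ c, I ≤ RingHom.ker f := by
  choose C inst f hf hker using fun I : c => h I I.2
  have : Nonempty c := hne.to_subtype
  have : IsDirected c (· ≤ ·) := ⟨fun a b => (hc.total a.2 b.2).elim
    (fun hab => ⟨b, hab, le_rfl⟩) fun hba => ⟨a, le_rfl, hba⟩⟩
  obtain ⟨P, _, q, hq, hmem⟩ := exists_reducedProduct (atTop : Filter c) fun I => (f I).comp φ
  refine ⟨P, _, q.comp (RingHom.pi f), isCMwrt_reducedProduct hq hmem hf, fun I hI b hb => ?_⟩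
  have h0 := (hmem ⊥ Submodule.fg_bot (RingHom.pi f b)).2
  rw [Ideal.map_bot, Ideal.mem_bot] at h0
  refine h0 ?_
  filter_upwards [eventually_ge_atTop (⟨I, hI⟩ : c)] with J hJ
  have : f J b = 0 := hker J (hJ hb)
  simp [this]

variable {S : Type} [CommRing S] [IsNoetherianRing S] [IsLocalRing S] {d : ℕ} {x : Fin d → S}
  {p : ℕ} [CharP S p]

/-- Every Cohen-Macaulay algebra maps to a separated perfect big Cohen-Macaulay algebra with
prime kernel. -/
lemma IsCMwrt.exists_isPrime_ker (hp : p.Prime) (hx : IsSOP S x) {B : Type} [CommRing B]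
    {φ : S →+* B} (h : IsCMwrt φ x) :
    ∃ (C : Type) (_ : CommRing C) (f : B →+* C),
      IsSeparatedPerfectBigCM p (f.comp φ) x ∧ (RingHom.ker f).IsPrime := by
  let F : Set (Ideal B) := {I | ∃ (C : Type) (_ : CommRing C) (f : B →+* C),
    IsCMwrt (f.comp φ) x ∧ I ≤ RingHom.ker f}
  obtain ⟨M, -, hM⟩ := zorn_le_nonempty₀ F (fun c hcF hc I hI => by
    obtain ⟨C, _, f, hf, hle⟩ := exists_isCMwrt_forall_le_ker hc ⟨I, hI⟩ fun I hI => hcF hI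
    exact ⟨RingHom.ker f, ⟨C, _, f, hf, le_rfl⟩, hle⟩) ⊥
    ⟨B, _, RingHom.id B, h, bot_le⟩
  obtain ⟨C₀, _, f₀, hf₀, hle₀⟩ := hM.prop
  obtain ⟨C, _, f₁, hC⟩ := hf₀.exists_isSeparatedPerfectBigCM hp hx
  let f := f₁.comp f₀
  have hf : IsSeparatedPerfectBigCM p (f.comp φ) x := hC
  have hCM := hf.isBigCM d x hx
  have hMf : M ≤ RingHom.ker f := fun b hb => by
    have : f₀ b = 0 := hle₀ hb
    simp [f, RingHom.mem_ker, this]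
  refine ⟨C, _, f, hf, ?_, fun {a b} hab => ?_⟩
  · have := hCM.nontrivial
    exact RingHom.ker_ne_top f
  · by_cases ha : f a = 0
    · exact Or.inl ha
    · right
      obtain ⟨E, _, g, hg, hg0⟩ := hf.exists_isCMwrt_of_mul_eq_zero hp hx ha
      have hb : g (f b) = 0 := hg0 _ (by rw [← map_mul]; exact hab)
      have hker : RingHom.ker (g.comp f) ∈ F := ⟨E, _, g.comp f, hg, le_rfl⟩
      have hMg : M ≤ RingHom.ker (g.comp f) := fun c hc => by
        have : f c = 0 := hMf hc
        simp [RingHom.mem_ker, this]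
      exact hMf (hM.le_of_ge hker hMg hb)

/-- A bundled separated perfect big Cohen-Macaulay algebra. -/
structure SeparatedPerfectBigCMAlgebra {S : Type} [CommRing S] [IsLocalRing S] (p : ℕ) {d : ℕ}
    (x : Fin d → S) where
  carrier : Type
  [commRing : CommRing carrier]
  hom : S →+* carrier
  isSeparatedPerfectBigCM : IsSeparatedPerfectBigCM p hom x

attribute [instance] SeparatedPerfectBigCMAlgebra.commRing

lemma SeparatedPerfectBigCMAlgebra.exists_sequence (hp : p.Prime) (hx : IsSOP S x)
    (B : SeparatedPerfectBigCMAlgebra p x) :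
    ∃ (A : ℕ → SeparatedPerfectBigCMAlgebra p x) (f : ∀ n, (A n).carrier →+* (A (n + 1)).carrier),
      A 0 = B ∧ ∀ n, (f n).comp (A n).hom = (A (n + 1)).hom ∧ (RingHom.ker (f n)).IsPrime := by
  have step : ∀ A : SeparatedPerfectBigCMAlgebra p x, ∃ (A' : SeparatedPerfectBigCMAlgebra p x)
      (f : A.carrier →+* A'.carrier), f.comp A.hom = A'.hom ∧ (RingHom.ker f).IsPrime := by
    intro A
    obtain ⟨C, _, f, hf, hker⟩ :=
      (A.isSeparatedPerfectBigCM.isBigCM d x hx).exists_isPrime_ker hp hx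
    exact ⟨⟨C, f.comp A.hom, hf⟩, f, rfl, hker⟩
  choose next f hf using step
  exact ⟨fun n => n.rec B fun _ A => next A, fun n => f _, rfl, fun n => hf _⟩

/-- Every Cohen-Macaulay algebra maps to a perfect big Cohen-Macaulay domain. -/
lemma IsCMwrt.exists_isDomain (hp : p.Prime) (hx : IsSOP S x) {B : Type} [CommRing B]
    {φ : S →+* B} (h : IsCMwrt φ x) :
    ∃ (C : Type) (_ : CommRing C) (f : B →+* C), IsDomain C ∧
      (Function.Bijective fun c : C => c ^ p) ∧ IsBigCM (f.comp φ) := by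
  obtain ⟨B', _, f', hB'⟩ := h.exists_isSeparatedPerfectBigCM hp hx
  obtain ⟨A, f, hA0, hf⟩ := SeparatedPerfectBigCMAlgebra.exists_sequence hp hx ⟨B', f'.comp φ, hB'⟩
  have hA : ∃ f₀ : B →+* (A 0).carrier, f₀.comp φ = (A 0).hom := by
    rw [hA0]
    exact ⟨f', rfl⟩
  obtain ⟨f₀, hf₀⟩ := hA
  obtain ⟨C, _, g, t, gf, gt, tφ, surj, hmem⟩ := exists_sequentialColimit
    (fun n => (A n).hom) f fun n => (hf n).1
  have hCM : IsBigCM ((g 0).comp (A 0).hom) := fun d' y hy =>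
    isCMwrt_sequentialColimit gt tφ surj hmem fun n => (A n).isSeparatedPerfectBigCM.isBigCM d' y hy
  have hzero : ∀ n b, g n b = 0 → ∃ m, ∃ h : n ≤ m, t n m h b = 0 := by
    intro n b hb
    have := hmem ⊥ n b (hb ▸ Ideal.zero_mem _)
    simpa using this
  have hnt : Nontrivial C := (hCM d x hx).nontrivial
  have hdom : NoZeroDivisors C := by
    refine ⟨fun {a b} hab => ?_⟩
    have hcommon : ∃ n a' b', g n a' = a ∧ g n b' = b := by
      obtain ⟨n, a', rfl⟩ := surj a
      obtain ⟨m, b', rfl⟩ := surj b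
      refine ⟨max n m, t _ _ (le_max_left n m) a', t _ _ (le_max_right n m) b', ?_, ?_⟩ <;>
        rw [← RingHom.comp_apply, gt]
    obtain ⟨n, a', b', rfl, rfl⟩ := hcommon
    obtain ⟨m, hnm, hm⟩ := hzero n (a' * b') (by rw [map_mul, hab])
    rw [map_mul] at hm
    have hker : t n m hnm a' * t n m hnm b' ∈ RingHom.ker (f m) := hm ▸ Ideal.zero_mem _
    have hz : ∀ c, t n m hnm c ∈ RingHom.ker (f m) → g n c = 0 := by
      intro c hc
      rw [← gt n m hnm, ← gf m, RingHom.comp_apply, RingHom.comp_apply, (RingHom.mem_ker).1 hc,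
        map_zero]
    exact ((hf m).2.mem_or_mem hker).imp (hz _) (hz _)
  refine ⟨C, _, (g 0).comp f₀, NoZeroDivisors.to_isDomain C, ⟨?_, fun c => ?_⟩, ?_⟩
  · have := charP_of_ringHom hp ((g 0).comp (A 0).hom)
    exact injective_pow_char hp fun b hb => eq_zero_of_pow_eq_zero hb
  · obtain ⟨n, b, rfl⟩ := surj c
    obtain ⟨r, rfl⟩ := (A n).isSeparatedPerfectBigCM.perfect.2 b
    exact ⟨g n r, (map_pow _ _ _).symm⟩
  · rwa [RingHom.comp_assoc, hf₀]

end Domain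

section DirectedSystem

open Filter

variable {S : Type} [CommRing S] {d : ℕ} {x : Fin d → S}

/-- If each member of a directed system of `S`-algebras maps to a Cohen-Macaulay algebra, so does
the direct limit. -/
lemma exists_isCMwrt_of_directedSystem {ι : Type} [Preorder ι] [IsDirected ι (· ≤ ·)] [Nonempty ι]
    {D : ι → Type} [∀ i, CommRing (D i)] (φ : ∀ i, S →+* D i)
    (t : ∀ i j : ι, i ≤ j → D i →+* D j)
    (ht_comp : ∀ (i j l : ι) (hij : i ≤ j) (hjl : j ≤ l),
      (t j l hjl).comp (t i j hij) = t i l (hij.trans hjl))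
    (ht_alg : ∀ (i j : ι) (hij : i ≤ j), (t i j hij).comp (φ i) = φ j)
    (h : ∀ i, ∃ (C : Type) (_ : CommRing C) (g : D i →+* C), IsCMwrt (g.comp (φ i)) x) :
    ∃ (C : Type) (_ : CommRing C) (ψ : S →+* C) (g : ∀ i, D i →+* C), IsCMwrt ψ x ∧
      (∀ i j (hij : i ≤ j), (g j).comp (t i j hij) = g i) ∧ ∀ i, (g i).comp (φ i) = ψ := by
  classical
  choose B inst f hf using h
  obtain ⟨C, _, q, hq, hmem⟩ := exists_reducedProduct (atTop : Filter ι) fun i => (f i).comp (φ i)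
  have hcongr : ∀ (i : ι) (a b : ∀ j, B j), (∀ j, i ≤ j → a j = b j) → q a = q b := by
    intro i a b hab
    have h0 := (hmem ⊥ Submodule.fg_bot (a - b)).2
    rw [Ideal.map_bot, Ideal.mem_bot, map_sub, sub_eq_zero] at h0
    refine h0 ?_
    filter_upwards [eventually_ge_atTop i] with j hj
    simp [hab j hj]
  let u : ∀ i, D i → ∀ j, B j := fun i a j => if hij : i ≤ j then f j (t i j hij a) else 0
  have hu : ∀ i a j (hij : i ≤ j), u i a j = f j (t i j hij a) := fun i a j hij => dif_pos hij
  let g : ∀ i, D i →+* C := fun i =>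
    { toFun := fun a => q (u i a)
      map_one' := by
        rw [← map_one q]
        exact hcongr i _ _ fun j hij => by simp [hu _ _ _ hij]
      map_mul' := fun a b => by
        rw [← map_mul q]
        exact hcongr i _ _ fun j hij => by simp [hu _ _ _ hij]
      map_zero' := by
        rw [← map_zero q]
        exact hcongr i _ _ fun j hij => by simp [hu _ _ _ hij]
      map_add' := fun a b => by
        rw [← map_add q]
        exact hcongr i _ _ fun j hij => by simp [hu _ _ _ hij] }
  refine ⟨C, _, q.comp (RingHom.pi fun i => (f i).comp (φ i)), g,
    isCMwrt_reducedProduct hq hmem hf, fun i j hij => ?_, fun i => ?_⟩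
  · ext a
    refine hcongr j _ _ fun l hjl => ?_
    rw [hu _ _ _ hjl, hu _ _ _ (hij.trans hjl), ← ht_comp i j l hij hjl]
    rfl
  · ext s
    refine hcongr i _ _ fun j hij => ?_
    rw [hu _ _ _ hij, ← RingHom.comp_apply (t i j hij), ht_alg]
    rfl

end DirectedSystem

/-- **Proposition 3.2 (2)** (after Dietz): a directed system of almost Cohen-Macaulay
`S`-algebras (each `D i` almost Cohen-Macaulay with respect to its own compatible system of
`p`-th power roots of a nonzero element) admits, on its direct limit, an `S`-algebra
homomorphism to a big Cohen-Macaulay `S`-algebra which is a perfect domain; equivalently,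
there is a compatible cocone of ring homomorphisms `g i : D i →+* C` into such a `C`. -/
theorem directed_system_almost_CM_maps_to_perfect_CM
    (p : ℕ) (hp : p.Prime)
    (k : Type) [Field k] [IsAlgClosed k] [CharP k p]
    (S : Type) [CommRing S] [IsNoetherianRing S] [IsLocalRing S] [Algebra k S]
    [IsAdicComplete (IsLocalRing.maximalIdeal S) S]
    (hres : Function.Bijective ((IsLocalRing.residue S).comp (algebraMap k S)))
    (d : ℕ) (x : Fin d → S) (hx : IsSOP S x)
    (ι : Type) [Preorder ι] [IsDirected ι (· ≤ ·)] [Nonempty ι]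
    (D : ι → Type) [∀ i, CommRing (D i)] [∀ i, Algebra S (D i)]
    (t : ∀ i j : ι, i ≤ j → D i →+* D j)
    (ht_id : ∀ i : ι, t i i le_rfl = RingHom.id (D i))
    (ht_comp : ∀ (i j l : ι) (hij : i ≤ j) (hjl : j ≤ l),
      (t j l hjl).comp (t i j hij) = t i l (hij.trans hjl))
    (ht_alg : ∀ (i j : ι) (hij : i ≤ j) (s : S),
      t i j hij (algebraMap S (D i) s) = algebraMap S (D j) s)
    (π : ∀ i : ι, ℕ → D i)
    (hπ : ∀ (i : ι) (e : ℕ), π i (e + 1) ^ p = π i e)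
    (hπ0 : ∀ i : ι, π i 0 ≠ 0)
    (hACM : ∀ i : ι, IsAlmostCMwrt (algebraMap S (D i)) (π i) x) :
    ∃ (C : Type) (_ : CommRing C) (g : ∀ i : ι, D i →+* C),
      IsDomain C ∧
      (Function.Bijective fun c : C => c ^ p) ∧
      (∀ (i j : ι) (hij : i ≤ j), (g j).comp (t i j hij) = g i) ∧
      (∀ (i j : ι) (s : S),
        g i (algebraMap S (D i) s) = g j (algebraMap S (D j) s)) ∧
      (∀ i : ι, IsBigCM ((g i).comp (algebraMap S (D i)))) := by
  have hchar : CharP S p := charP_of_injective_ringHom (algebraMap k S).injective p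
  obtain ⟨B, _, ψ, g, hψ, hgt, hgφ⟩ := exists_isCMwrt_of_directedSystem (x := x)
    (fun i => algebraMap S (D i)) t ht_comp (fun i j hij => RingHom.ext (ht_alg i j hij))
    fun i => by
      obtain ⟨C, _, f, hf, -⟩ := (hACM i).exists_isCMwrt hp (hπ i)
      exact ⟨C, _, f, hf⟩
  obtain ⟨C, _, f, hdom, hperf, hCM⟩ := hψ.exists_isDomain hp hx
  have hfg : ∀ i, (f.comp (g i)).comp (algebraMap S (D i)) = f.comp ψ := fun i => by
    rw [RingHom.comp_assoc, hgφ]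
  refine ⟨C, _, fun i => f.comp (g i), hdom, hperf, fun i j hij => ?_, fun i j s => ?_,
    fun i => ?_⟩
  · rw [RingHom.comp_assoc, hgt]
  · exact RingHom.congr_fun ((hfg i).trans (hfg j).symm) s
  · rwa [hfg]
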